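/- arXiv:2602.16028 — 2 statements merged into one kernel-verified Lean document; each statement's English description precedes it below -/
import Mathlib

section
/- For every integer n ≥ 3 there is a constant c(n) depending only on n with the following property. Let M = (Ω, P) be a canonical partially observable Markov chain with |Ω| = n and sink s, and let 𝒫₀ = {Ω∖{s}, {s}}, 𝒫₁, …, 𝒫_k be partitions of Ω such that each 𝒫_i refines 𝒫_{i−1} and each weight w(𝒫_{i−1}, 𝒫_i) is finite, and set L = Π_{i=1}^{k} w(𝒫_{i−1}, 𝒫_i), assuming L ≥ 2. Then there exist a non-adaptive rewinding strategy A, a time T ≤ c(n) · L · (log L)^k, and a function f from observation sequences of length T+1 to the classes of 𝒫_k, such that for every initial state x ∈ Ω, with probability at least 2/3 the process started at X₀ = x satisfies f(Z₀, …, Z_T) = 𝒫_k(x). -/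
open Finset
open scoped ENNReal

/-- A canonical partially observable Markov chain: a finite state space with a
distinguished absorbing sink state; `P x y` is the probability of moving from `x` to `y`. -/
structure Canonical (Ω : Type) [Fintype Ω] [DecidableEq Ω] where
  P : Ω → Ω → ℝ
  sink : Ω
  nonneg : ∀ x y, 0 ≤ P x y
  sum_one : ∀ x, ∑ y, P x y = 1
  sink_absorb : P sink sink = 1

variable {Ω : Type} [Fintype Ω] [DecidableEq Ω]

/-- Observation: `true` iff the state is the sink. -/
def Canonical.obs (M : Canonical Ω) (x : Ω) : Bool := decide (x = M.sink)

/-- The observation history `Z₀, …, Z_t` of a state trajectory `g`. -/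
def obsHist (M : Canonical Ω) (g : ℕ → Ω) (t : ℕ) : List Bool :=
  (List.range (t + 1)).map fun i => M.obs (g i)

/-- Probability of the state trajectory `g` (conditionally on its initial state `g 0`)
under rewinding strategy `A`, for `T` steps: at each time `t`, the next state `g (t+1)` is
drawn from the state at time `t - A(Z₀,…,Z_t)` (truncated subtraction realizes `max 0 _`). -/
noncomputable def trajProb (M : Canonical Ω) (A : List Bool → ℕ) (T : ℕ) (g : ℕ → Ω) : ℝ :=
  ∏ t ∈ Finset.range T, M.P (g (t - A (obsHist M g t))) (g (t + 1))

/-- Extend `f : Fin (T+1) → Ω` to `ℕ → Ω` by clamping. -/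
def extendTraj {Ω : Type} (T : ℕ) (f : Fin (T + 1) → Ω) : ℕ → Ω :=
  fun n => f ⟨min n T, Nat.lt_succ_of_le (min_le_right n T)⟩

/-- The probability that the chain `M` with rewinding strategy `A`, started at `x`,
produces the observation sequence `z = (Z₀, …, Z_T)`.  This is the distribution `D_T^{A,x}`. -/
noncomputable def obsSeqProb (M : Canonical Ω) (A : List Bool → ℕ) (x : Ω) (T : ℕ)
    (z : Fin (T + 1) → Bool) : ℝ :=
  ∑ f : Fin (T + 1) → Ω,
    if f 0 = x ∧ (∀ i, M.obs (f i) = z i) then trajProb M A T (extendTraj T f) else 0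

/-- Total variation distance between the observation-sequence distributions
`D_T^{A,a}` and `D_T^{A,b}`. -/
noncomputable def obsTV (M : Canonical Ω) (A : List Bool → ℕ) (a b : Ω) (T : ℕ) : ℝ :=
  (1 / 2) * ∑ z : Fin (T + 1) → Bool, |obsSeqProb M A a T z - obsSeqProb M A b T z|

/-- A rewinding strategy is non-adaptive if it depends only on the length of the history. -/
def NonAdaptive (A : List Bool → ℕ) : Prop :=
  ∀ l₁ l₂ : List Bool, l₁.length = l₂.length → A l₁ = A l₂

/-- Query complexity `QC^A_M(a,b)`: the least `T` with `d_TV(D_T^{A,a}, D_T^{A,b}) ≥ 1/3`,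
as an element of `ℝ≥0∞` (`⊤` if no such `T` exists). -/
noncomputable def QC (M : Canonical Ω) (A : List Bool → ℕ) (a b : Ω) : ℝ≥0∞ :=
  sInf {x : ℝ≥0∞ | ∃ T : ℕ, x = (T : ℝ≥0∞) ∧ 1 / 3 ≤ obsTV M A a b T}

/-- Adaptive query complexity: infimum over all rewinding strategies. -/
noncomputable def AQC (M : Canonical Ω) (a b : Ω) : ℝ≥0∞ :=
  ⨅ A : List Bool → ℕ, QC M A a b

/-- Non-adaptive query complexity: infimum over all non-adaptive rewinding strategies. -/
noncomputable def NAQC (M : Canonical Ω) (a b : Ω) : ℝ≥0∞ :=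
  ⨅ A : {A : List Bool → ℕ // NonAdaptive A}, QC M A.1 a b
/-- A partition of a finite type `Ω`, given by the map sending each element to its class. -/
structure Partn (Ω : Type) [Fintype Ω] [DecidableEq Ω] where
  cls : Ω → Finset Ω
  mem_cls : ∀ x, x ∈ cls x
  cls_eq : ∀ x y, y ∈ cls x → cls y = cls x

/-- `probOf P x C = P(C|x)`, the probability that the next state after `x` lies in `C`. -/
noncomputable def probOf {Ω : Type} [Fintype Ω] (P : Ω → Ω → ℝ) (x : Ω) (C : Finset Ω) : ℝ :=
  ∑ y ∈ C, P x y

/-- Projected total variation distance `d_TV^Pt(a,b)`. -/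
noncomputable def dTVP {Ω : Type} [Fintype Ω] [DecidableEq Ω] (P : Ω → Ω → ℝ)
    (Pt : Partn Ω) (a b : Ω) : ℝ :=
  (1 / 2) * ∑ C ∈ Finset.univ.image Pt.cls, |probOf P a C - probOf P b C|

/-- `Pt'` refines `Pt` if every class of `Pt'` is contained in a class of `Pt`. -/
def Refines {Ω : Type} [Fintype Ω] [DecidableEq Ω] (Pt' Pt : Partn Ω) : Prop :=
  ∀ x, Pt'.cls x ⊆ Pt.cls x

/-- The weight `w(Pt,Pt')`: the maximum of `1/d_TV^Pt(x,y)²` over pairs `x, y` lying in the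
same class of `Pt` but different classes of `Pt'` (valued in `ℝ≥0∞`; `1/0 = ⊤`). -/
noncomputable def wgt {Ω : Type} [Fintype Ω] [DecidableEq Ω] (P : Ω → Ω → ℝ)
    (Pt Pt' : Partn Ω) : ℝ≥0∞ :=
  ⨆ (x : Ω) (y : Ω) (_ : Pt.cls x = Pt.cls y ∧ Pt'.cls x ≠ Pt'.cls y),
    (ENNReal.ofReal ((dTVP P Pt x y) ^ 2))⁻¹

/-- A finite rooted ordered tree of samples: `branch c r` samples a successor of the root,
explores it according to `c`, and then continues exploring the root according to `r`. -/
inductive Plan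
  | leaf : Plan
  | branch : Plan → Plan → Plan

namespace Plan

/-- The number of samples drawn by a plan. -/
def size : Plan → ℕ
  | leaf => 0
  | branch c r => c.size + 1 + r.size

/-- The indices of the states from which the successive samples of a plan are drawn, when the
root has index `i` and `N` states have been generated so far. -/
def parents : Plan → ℕ → ℕ → List ℕ
  | leaf, _, _ => []
  | branch c r, i, N => i :: (c.parents N (N + 1) ++ r.parents i (N + 1 + c.size))

theorem length_parents (p : Plan) : ∀ i N, (p.parents i N).length = p.size := by
  induction p with
  | leaf => simp [parents, size]
  | branch c r hc hr =>
    intro i N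
    simp only [parents, size, List.length_cons, List.length_append, hc, hr]
    omega

/-- The expectation of `h` over the list of states sampled by a plan started at `x`. -/
noncomputable def mean (M : Canonical Ω) : Plan → Ω → (List Ω → ℝ) → ℝ
  | leaf, _, h => h []
  | branch c r, x, h =>
    ∑ y, M.P x y * mean M c y fun l₁ => mean M r x fun l₂ => h (y :: (l₁ ++ l₂))

variable (M : Canonical Ω)

theorem mean_mono (p : Plan) : ∀ (x : Ω) {h h' : List Ω → ℝ},
    (∀ l, l.length = p.size → h l ≤ h' l) → p.mean M x h ≤ p.mean M x h' := by
  induction p with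
  | leaf => intro x h h' H; exact H [] rfl
  | branch c r hc hr =>
    intro x h h' H
    refine Finset.sum_le_sum fun y _ => mul_le_mul_of_nonneg_left ?_ (M.nonneg x y)
    refine hc y fun l₁ h₁ => hr x fun l₂ h₂ => H _ ?_
    simp only [size, List.length_cons, List.length_append, h₁, h₂]
    omega

theorem mean_congr (p : Plan) (x : Ω) {h h' : List Ω → ℝ}
    (H : ∀ l, l.length = p.size → h l = h' l) : p.mean M x h = p.mean M x h' :=
  le_antisymm (p.mean_mono M x fun l hl => (H l hl).le) (p.mean_mono M x fun l hl => (H l hl).ge)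

theorem mean_add (p : Plan) : ∀ (x : Ω) (h h' : List Ω → ℝ),
    p.mean M x (fun l => h l + h' l) = p.mean M x h + p.mean M x h' := by
  induction p with
  | leaf => intro x h h'; rfl
  | branch c r hc hr =>
    intro x h h'
    simp only [mean, hr, hc, mul_add, Finset.sum_add_distrib]

theorem mean_mul (p : Plan) (a : ℝ) : ∀ (x : Ω) (h : List Ω → ℝ),
    p.mean M x (fun l => a * h l) = a * p.mean M x h := by
  induction p with
  | leaf => intro x h; rfl
  | branch c r hc hr =>
    intro x h
    simp only [mean, hr, hc, Finset.mul_sum]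
    exact Finset.sum_congr rfl fun y _ => by ring

theorem mean_const (p : Plan) (a : ℝ) : ∀ x : Ω, p.mean M x (fun _ => a) = a := by
  induction p with
  | leaf => intro x; rfl
  | branch c r hc hr =>
    intro x
    simp only [mean, hr, hc, ← Finset.sum_mul, M.sum_one, one_mul]

theorem mean_sum {ι : Type*} (p : Plan) (x : Ω) (s : Finset ι) (h : ι → List Ω → ℝ) :
    p.mean M x (fun l => ∑ i ∈ s, h i l) = ∑ i ∈ s, p.mean M x (h i) := by
  classical
  induction s using Finset.induction_on with
  | empty => simpa using p.mean_const M 0 x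
  | insert i s hi ih => simp only [Finset.sum_insert hi, mean_add, ih]

end Plan

/-- The expectation of `h` over the list of all states, when the states `hist` are given and the
further states are sampled successively from the states with indices `qs`. -/
noncomputable def seqMean (M : Canonical Ω) : List ℕ → List Ω → (List Ω → ℝ) → ℝ
  | [], hist, h => h hist
  | q :: qs, hist, h =>
    ∑ y, M.P (hist.getD (hist.length - 1 - (hist.length - 1 - q)) M.sink) y *
      seqMean M qs (hist ++ [y]) h

theorem seqMean_parents (M : Canonical Ω) (h : List Ω → ℝ) (p : Plan) :
    ∀ (i : ℕ) (hist : List Ω) (qs : List ℕ), i < hist.length →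
      seqMean M (p.parents i hist.length ++ qs) hist h =
        p.mean M (hist.getD i M.sink) fun l => seqMean M qs (hist ++ l) h := by
  induction p with
  | leaf => intro i hist qs hi; simp [Plan.parents, Plan.mean]
  | branch c r hc hr =>
    intro i hist qs hi
    have e : hist.length - 1 - (hist.length - 1 - i) = i := by omega
    simp only [Plan.parents, Plan.mean, List.cons_append, seqMean, e, List.append_assoc]
    refine Finset.sum_congr rfl fun y _ => ?_
    congr 1
    have := hc hist.length (hist ++ [y]) (r.parents i (hist.length + 1 + c.size) ++ qs) (by simp)
    rw [List.length_append, List.length_singleton] at this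
    rw [this]
    have e1 : (hist ++ [y]).getD hist.length M.sink = y := by simp
    rw [e1]
    refine c.mean_congr M y fun l hl => ?_
    have h2 := hr i (hist ++ [y] ++ l) qs (by simp; omega)
    have e2 : (hist ++ [y] ++ l).length = hist.length + 1 + c.size := by simp [hl]; omega
    have e3 : (hist ++ [y] ++ l).getD i M.sink = hist.getD i M.sink := by
      simp [List.getElem?_append, hi]
    rw [e2, e3] at h2
    rw [h2]
    simp

/-- The expectation of `H` over the list of the states at times `0, …, T`, when the state at time
`t + 1` is sampled from the state at time `min t (a t)`. -/
noncomputable def trajMean (M : Canonical Ω) (a : ℕ → ℕ) (x : Ω) (T : ℕ) (H : List Ω → ℝ) : ℝ :=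
  ∑ g : Fin (T + 1) → Ω, if g 0 = x then
    (∏ t ∈ Finset.range T, M.P (extendTraj T g (t - (t - a t))) (extendTraj T g (t + 1))) *
      H (List.ofFn g) else 0

theorem extendTraj_snoc_of_le {α : Type} {T t : ℕ} (g : Fin (T + 1) → α) (y : α) (ht : t ≤ T) :
    extendTraj (T + 1) (Fin.snoc g y : Fin (T + 2) → α) t = extendTraj T g t := by
  unfold extendTraj
  have : (⟨min t (T + 1), Nat.lt_succ_of_le (min_le_right _ _)⟩ : Fin (T + 2)) =
      Fin.castSucc ⟨min t T, Nat.lt_succ_of_le (min_le_right _ _)⟩ := by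
    ext; simp; omega
  rw [this, Fin.snoc_castSucc]

theorem extendTraj_snoc_last {α : Type} {T : ℕ} (g : Fin (T + 1) → α) (y : α) :
    extendTraj (T + 1) (Fin.snoc g y : Fin (T + 2) → α) (T + 1) = y := by
  unfold extendTraj
  have : (⟨min (T + 1) (T + 1), Nat.lt_succ_of_le (min_le_right _ _)⟩ : Fin (T + 2)) =
      Fin.last (T + 1) := by
    ext; simp
  rw [this, Fin.snoc_last]

theorem trajMean_succ (M : Canonical Ω) (a : ℕ → ℕ) (x : Ω) (T : ℕ) (H : List Ω → ℝ) :
    trajMean M a x (T + 1) H = trajMean M a x T fun hist =>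
      ∑ y, M.P (hist.getD (T - (T - a T)) M.sink) y * H (hist ++ [y]) := by
  unfold trajMean
  rw [← (Fin.snocEquiv fun _ : Fin (T + 2) => Ω).sum_comp, Fintype.sum_prod_type_right]
  refine Finset.sum_congr rfl fun g _ => ?_
  have h0 : ∀ y : Ω, (Fin.snoc g y : Fin (T + 2) → Ω) 0 = g 0 := fun y => by
    simp
  have hL : ∀ y : Ω, List.ofFn (Fin.snoc g y : Fin (T + 2) → Ω) = List.ofFn g ++ [y] := fun y => by
    rw [List.ofFn_succ']
    simp
  have hP : ∀ y : Ω, ∏ t ∈ Finset.range (T + 1),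
      M.P (extendTraj (T + 1) (Fin.snoc g y : Fin (T + 2) → Ω) (t - (t - a t)))
        (extendTraj (T + 1) (Fin.snoc g y : Fin (T + 2) → Ω) (t + 1)) =
      (∏ t ∈ Finset.range T, M.P (extendTraj T g (t - (t - a t))) (extendTraj T g (t + 1))) *
        M.P ((List.ofFn g).getD (T - (T - a T)) M.sink) y := fun y => by
    rw [Finset.prod_range_succ, extendTraj_snoc_last, extendTraj_snoc_of_le _ _ (Nat.sub_le _ _)]
    congr 1
    · refine Finset.prod_congr rfl fun t ht => ?_
      have := Finset.mem_range.1 ht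
      rw [extendTraj_snoc_of_le _ _ (by omega), extendTraj_snoc_of_le _ _ (by omega)]
    · have : T - (T - a T) < T + 1 := by omega
      congr 1
      rw [List.getD_eq_getElem _ _ (by simp), List.getElem_ofFn]
      unfold extendTraj
      congr 1
      ext
      simp
  simp only [Fin.snocEquiv, Equiv.coe_fn_mk, h0, hL, hP]
  by_cases hx : g 0 = x
  · simp only [hx, if_true, Finset.mul_sum, mul_assoc]
  · simp [hx]

theorem trajMean_eq_seqMean (M : Canonical Ω) (qs : List ℕ) (x : Ω) (H : List Ω → ℝ) :
    trajMean M (fun t => qs.getD t 0) x qs.length H = seqMean M qs [x] H := by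
  have key : ∀ T ≤ qs.length, trajMean M (fun t => qs.getD t 0) x T
      (fun hist => seqMean M (qs.drop T) hist H) = seqMean M qs [x] H := by
    intro T
    induction T with
    | zero =>
      intro _
      unfold trajMean
      rw [← (Equiv.funUnique (Fin 1) Ω).symm.sum_comp]
      simp [List.ofFn_succ]
    | succ T ih =>
      intro hT
      rw [trajMean_succ, ← ih (by omega)]
      unfold trajMean
      refine Finset.sum_congr rfl fun g _ => ?_
      congr 2
      beta_reduce
      conv_rhs => rw [List.drop_eq_getElem_cons (by omega : T < qs.length), seqMean]
      simp [List.getElem?_eq_getElem (by omega : T < qs.length)]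
  simpa [seqMean] using key qs.length le_rfl

/-- The non-adaptive rewinding strategy whose state at time `t + 1` is sampled from the state at
time `min t (a t)`. -/
def rewindTo (a : ℕ → ℕ) (l : List Bool) : ℕ := l.length - 1 - a (l.length - 1)

theorem nonAdaptive_rewindTo (a : ℕ → ℕ) : NonAdaptive (rewindTo a) := by
  intro l₁ l₂ h
  simp [rewindTo, h]

theorem sum_obsSeqProb_rewindTo (M : Canonical Ω) (a : ℕ → ℕ) (x : Ω) (T : ℕ)
    (f : List Bool → Finset Ω) (C : Finset Ω) :
    (∑ z : Fin (T + 1) → Bool,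
      if f (List.ofFn z) = C then obsSeqProb M (rewindTo a) x T z else 0) =
      trajMean M a x T fun l => if f (l.map M.obs) = C then 1 else 0 := by
  unfold obsSeqProb trajMean
  have e : ∀ z : Fin (T + 1) → Bool, (if f (List.ofFn z) = C then
      ∑ g : Fin (T + 1) → Ω, (if g 0 = x ∧ ∀ i, M.obs (g i) = z i then
        trajProb M (rewindTo a) T (extendTraj T g) else 0) else 0) =
      ∑ g : Fin (T + 1) → Ω, if z = M.obs ∘ g then (if g 0 = x then
        trajProb M (rewindTo a) T (extendTraj T g) *
          (if f ((List.ofFn g).map M.obs) = C then 1 else 0) else 0) else 0 := by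
    intro z
    have hz : ∀ g : Fin (T + 1) → Ω, (∀ i, M.obs (g i) = z i) ↔ z = M.obs ∘ g := fun g =>
      ⟨fun h => funext fun i => (h i).symm, fun h i => by rw [h]; rfl⟩
    split_ifs with hC
    · refine Finset.sum_congr rfl fun g _ => ?_
      simp only [hz]
      by_cases hg : z = M.obs ∘ g
      · have : f ((List.ofFn g).map M.obs) = C := by
          rw [List.map_ofFn, ← hg, hC]
        simp only [hg, this, and_true, if_true, mul_one]
      · simp [hg]
    · symm
      refine Finset.sum_eq_zero fun g _ => ?_
      by_cases hg : z = M.obs ∘ g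
      · have : f ((List.ofFn g).map M.obs) ≠ C := by
          rwa [List.map_ofFn, ← hg]
        simp only [this, if_false, mul_zero, ite_self]
      · simp [hg]
  rw [Finset.sum_congr rfl fun z _ => e z, Finset.sum_comm]
  refine Finset.sum_congr rfl fun g _ => ?_
  rw [Finset.sum_ite_eq']
  simp only [Finset.mem_univ, if_true]
  have : trajProb M (rewindTo a) T (extendTraj T g) = ∏ t ∈ Finset.range T,
      M.P (extendTraj T g (t - (t - a t))) (extendTraj T g (t + 1)) := by
    simp [trajProb, rewindTo, obsHist]
  rw [this]

theorem sum_obsSeqProb_parents (M : Canonical Ω) (p : Plan) (x : Ω) (f : List Bool → Finset Ω)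
    (C : Finset Ω) :
    (∑ z : Fin (p.size + 1) → Bool, if f (List.ofFn z) = C then
      obsSeqProb M (rewindTo fun t => (p.parents 0 1).getD t 0) x p.size z else 0) =
      p.mean M x fun l => if f ((x :: l).map M.obs) = C then 1 else 0 := by
  rw [sum_obsSeqProb_rewindTo]
  have h := trajMean_eq_seqMean M (p.parents 0 1) x fun l => if f (l.map M.obs) = C then 1 else 0
  rw [Plan.length_parents] at h
  rw [h]
  simpa [seqMean] using seqMean_parents M (fun l => if f (l.map M.obs) = C then 1 else 0) p 0 [x] []
    (by simp)

/-- The first `m` consecutive blocks of length `T + 1` of a list. -/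
def blocks {α : Type*} (T : ℕ) : ℕ → List α → List (List α)
  | 0, _ => []
  | m + 1, l => l.take (T + 1) :: blocks T m (l.drop (T + 1))

theorem blocks_map {α β : Type*} (T : ℕ) (f : α → β) : ∀ (m : ℕ) (l : List α),
    blocks T m (l.map f) = (blocks T m l).map (List.map f)
  | 0, _ => rfl
  | m + 1, l => by simp [blocks, ← List.map_drop, blocks_map T f m]

namespace Plan

/-- Sample `m` successors of the root, exploring each according to `p`, and then explore the root
itself according to `p`. -/
def iter (p : Plan) : ℕ → Plan
  | 0 => p
  | m + 1 => branch p (p.iter m)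

theorem size_iter (p : Plan) (m : ℕ) : (p.iter m).size + 1 = (m + 1) * (p.size + 1) := by
  induction m with
  | zero => simp [iter]
  | succ m ih =>
    simp only [iter, size]
    linarith

variable (M : Canonical Ω)

theorem mean_iter_drop (p : Plan) (x : Ω) (h : List Ω → ℝ) (m : ℕ) :
    ((p.iter m).mean M x fun l => h (l.drop (m * (p.size + 1)))) = p.mean M x h := by
  induction m with
  | zero => simp [iter]
  | succ m ih =>
    have e : ∀ y : Ω, (p.mean M y fun l₁ => (p.iter m).mean M x fun l₂ =>
        h ((y :: (l₁ ++ l₂)).drop ((m + 1) * (p.size + 1)))) = p.mean M x h := fun y => by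
      rw [← p.mean_const M (p.mean M x h) y]
      refine p.mean_congr M y fun l₁ h₁ => ?_
      rw [← ih]
      refine (p.iter m).mean_congr M x fun l₂ _ => ?_
      have : (m + 1) * (p.size + 1) = (l₁.length + m * (p.size + 1)) + 1 := by rw [h₁]; ring
      rw [this, List.drop_succ_cons, List.drop_append, List.drop_eq_nil_of_le (by omega)]
      simp
    simp only [iter, mean, e, ← Finset.sum_mul, M.sum_one, one_mul]

theorem mean_iter_exp (p : Plan) (x : Ω) (φ : List Ω → ℝ) (m : ℕ) :
    ((p.iter m).mean M x fun l => Real.exp ((blocks p.size m l).map φ).sum) =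
      (∑ y, M.P x y * p.mean M y fun l => Real.exp (φ (y :: l))) ^ m := by
  induction m with
  | zero => simp [iter, blocks, mean_const]
  | succ m ih =>
    have e : ∀ y : Ω, (p.mean M y fun l₁ => (p.iter m).mean M x fun l₂ =>
        Real.exp ((blocks p.size (m + 1) (y :: (l₁ ++ l₂))).map φ).sum) =
        (∑ y, M.P x y * p.mean M y fun l => Real.exp (φ (y :: l))) ^ m *
          p.mean M y fun l => Real.exp (φ (y :: l)) := fun y => by
      rw [← ih, ← mean_mul]
      refine p.mean_congr M y fun l₁ h₁ => ?_
      rw [mul_comm, ← mean_mul]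
      refine (p.iter m).mean_congr M x fun l₂ _ => ?_
      simp [blocks, ← h₁, Real.exp_add]
    simp only [iter, mean, e]
    rw [pow_succ, Finset.mul_sum]
    exact Finset.sum_congr rfl fun y _ => by ring

/-- The expectation of `φ` over the list of states obtained by sampling a successor of `x` and
exploring it. -/
noncomputable def succMean (p : Plan) (x : Ω) (φ : List Ω → ℝ) : ℝ :=
  ∑ y, M.P x y * p.mean M y fun l => φ (y :: l)

theorem mean_iter_exp_le (p : Plan) (x : Ω) (φ : List Ω → ℝ) (h0 : ∀ l, 0 ≤ φ l)
    (h1 : ∀ l, φ l ≤ 1) {a : ℝ} (ha : |a| ≤ 1) (m : ℕ) :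
    ((p.iter m).mean M x fun l => Real.exp (a * ((blocks p.size m l).map φ).sum)) ≤
      Real.exp (m * (a * p.succMean M x φ + a ^ 2)) := by
  have e : ∀ l : List Ω, a * ((blocks p.size m l).map φ).sum =
      ((blocks p.size m l).map fun B => a * φ B).sum := fun l => (List.sum_map_mul_left ..).symm
  simp only [e]
  rw [mean_iter_exp M p x fun B => a * φ B, Real.exp_nat_mul]
  refine pow_le_pow_left₀ (Finset.sum_nonneg fun y _ => mul_nonneg (M.nonneg x y) ?_) ?_ m
  · rw [← p.mean_const M 0 y]
    exact p.mean_mono M y fun l _ => (Real.exp_pos _).le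
  · have hy : ∀ y, (p.mean M y fun l => Real.exp (a * φ (y :: l))) ≤
        1 + a ^ 2 + a * p.mean M y fun l => φ (y :: l) := fun y => by
      rw [← p.mean_const M (1 + a ^ 2) y, ← mean_mul, ← mean_add]
      refine p.mean_mono M y fun l _ => ?_
      have hφ := h0 (y :: l)
      have hφ' := h1 (y :: l)
      have hb : |a * φ (y :: l)| ≤ 1 := by
        rw [abs_mul, abs_of_nonneg hφ]
        exact mul_le_one₀ ha hφ hφ'
      have := (abs_le.1 (Real.abs_exp_sub_one_sub_id_le hb)).2
      have : (a * φ (y :: l)) ^ 2 ≤ a ^ 2 := by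
        rw [mul_pow]
        exact mul_le_of_le_one_right (sq_nonneg a) (pow_le_one₀ hφ hφ')
      linarith
    calc _ ≤ ∑ y, M.P x y * (1 + a ^ 2 + a * p.mean M y fun l => φ (y :: l)) :=
          Finset.sum_le_sum fun y _ => mul_le_mul_of_nonneg_left (hy y) (M.nonneg x y)
      _ = a * p.succMean M x φ + a ^ 2 + 1 := by
          simp only [succMean, mul_add, Finset.sum_add_distrib, ← Finset.sum_mul, M.sum_one,
            Finset.mul_sum]
          rw [add_comm]
          have : ∀ y, M.P x y * (a * p.mean M y fun l => φ (y :: l)) =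
            a * (M.P x y * p.mean M y fun l => φ (y :: l)) := fun y => by ring
          simp only [this]
          ring
      _ ≤ _ := Real.add_one_le_exp _

theorem mean_iter_deviation_le (p : Plan) (x : Ω) (φ : List Ω → ℝ) (h0 : ∀ l, 0 ≤ φ l)
    (h1 : ∀ l, φ l ≤ 1) {ε : ℝ} (hε : 0 < ε) (hε1 : ε ≤ 1) (m : ℕ) (hm : 0 < m) :
    ((p.iter m).mean M x fun l =>
      if ε ≤ |((blocks p.size m l).map φ).sum / m - p.succMean M x φ| then 1 else 0) ≤
      2 * Real.exp (-(m * ε ^ 2 / 4)) := by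
  set ρ := p.succMean M x φ
  have hm' : (0 : ℝ) < m := by exact_mod_cast hm
  have ha : |ε / 2| ≤ 1 := by rw [abs_of_pos (by linarith)]; linarith
  have ha' : |-(ε / 2)| ≤ 1 := by rwa [abs_neg]
  have b := mean_iter_exp_le M p x φ h0 h1 ha m
  have b' := mean_iter_exp_le M p x φ h0 h1 ha' m
  calc _ ≤ (p.iter m).mean M x fun l =>
        Real.exp (-(m * (ε / 2 * ρ)) - m * ε ^ 2 / 2) *
          Real.exp (ε / 2 * ((blocks p.size m l).map φ).sum) +
        Real.exp (m * (ε / 2 * ρ) - m * ε ^ 2 / 2) *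
          Real.exp (-(ε / 2) * ((blocks p.size m l).map φ).sum) := by
        refine (p.iter m).mean_mono M x fun l _ => ?_
        rw [← Real.exp_add, ← Real.exp_add]
        generalize ((blocks p.size m l).map φ).sum = S
        split_ifs with h
        · have hS : S = m * (S / m) := by field_simp
          rcases le_abs.1 h with h | h
          · refine le_add_of_le_of_nonneg (Real.one_le_exp ?_) (Real.exp_pos _).le
            have := mul_le_mul_of_nonneg_left h (by positivity : 0 ≤ m * (ε / 2))
            rw [hS]
            nlinarith
          · refine le_add_of_nonneg_of_le (Real.exp_pos _).le (Real.one_le_exp ?_)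
            have := mul_le_mul_of_nonneg_left h (by positivity : 0 ≤ m * (ε / 2))
            rw [hS]
            nlinarith
        · positivity
    _ ≤ Real.exp (-(m * (ε / 2 * ρ)) - m * ε ^ 2 / 2) *
          Real.exp (m * (ε / 2 * ρ + (ε / 2) ^ 2)) +
        Real.exp (m * (ε / 2 * ρ) - m * ε ^ 2 / 2) *
          Real.exp (m * (-(ε / 2) * ρ + (-(ε / 2)) ^ 2)) := by
        rw [mean_add, mean_mul, mean_mul]
        gcongr
    _ = _ := by
        rw [← Real.exp_add, ← Real.exp_add, two_mul]
        congr 2 <;> ring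

end Plan

theorem Partn.mem_cls_iff (Pt : Partn Ω) (x y : Ω) : y ∈ Pt.cls x ↔ Pt.cls y = Pt.cls x :=
  ⟨Pt.cls_eq x y, fun h => h ▸ Pt.mem_cls y⟩

theorem probOf_eq_sum_ite (P : Ω → Ω → ℝ) (Pt : Partn Ω) (a : Ω) {C : Finset Ω}
    (hC : C ∈ Finset.univ.image Pt.cls) :
    probOf P a C = ∑ y, if Pt.cls y = C then P a y else 0 := by
  obtain ⟨x, -, rfl⟩ := Finset.mem_image.1 hC
  rw [probOf, ← Finset.sum_filter]
  refine Finset.sum_congr (Finset.ext fun y => ?_) fun _ _ => rfl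
  simp [Pt.mem_cls_iff]

theorem sum_probOf (M : Canonical Ω) (Pt : Partn Ω) (a : Ω) :
    ∑ C ∈ Finset.univ.image Pt.cls, probOf M.P a C = 1 := by
  rw [Finset.sum_congr rfl fun C hC => probOf_eq_sum_ite M.P Pt a hC, Finset.sum_comm,
    ← M.sum_one a]
  refine Finset.sum_congr rfl fun y _ => ?_
  rw [Finset.sum_ite_eq, if_pos (Finset.mem_image_of_mem _ (Finset.mem_univ y))]

theorem dTVP_nonneg (P : Ω → Ω → ℝ) (Pt : Partn Ω) (a b : Ω) : 0 ≤ dTVP P Pt a b :=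
  mul_nonneg (by norm_num) (Finset.sum_nonneg fun _ _ => abs_nonneg _)

theorem dTVP_le_one (M : Canonical Ω) (Pt : Partn Ω) (a b : Ω) : dTVP M.P Pt a b ≤ 1 := by
  have h : ∀ x C, 0 ≤ probOf M.P x C := fun x C => Finset.sum_nonneg fun y _ => M.nonneg x y
  have : ∑ C ∈ Finset.univ.image Pt.cls, |probOf M.P a C - probOf M.P b C| ≤
      ∑ C ∈ Finset.univ.image Pt.cls, (probOf M.P a C + probOf M.P b C) :=
    Finset.sum_le_sum fun C _ => abs_le.2 ⟨by linarith [h a C, h b C], by linarith [h a C, h b C]⟩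
  rw [Finset.sum_add_distrib, sum_probOf, sum_probOf] at this
  unfold dTVP
  linarith

/-- Running the plan `p` and decoding the observations with `dec` determines the class in `Pt` of
the initial state with error probability at most `δ`. -/
def IsTest (M : Canonical Ω) (Pt : Partn Ω) (p : Plan) (dec : List Bool → Finset Ω) (δ : ℝ) :
    Prop :=
  ∀ x, (p.mean M x fun l => if dec ((x :: l).map M.obs) = Pt.cls x then 0 else 1) ≤ δ

/-- The fraction of the `m` explored successors whose class is decoded by `dec` as `C`. -/
noncomputable def freq (T : ℕ) (dec : List Bool → Finset Ω) (m : ℕ) (C : Finset Ω)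
    (L : List Bool) : ℝ :=
  ((blocks T m L.tail).map fun B => if dec B = C then (1 : ℝ) else 0).sum / m

open Classical in
/-- The decoder that outputs the class in `Pt'` of a state whose class in `Pt` is the one decoded
for the root, and whose transition probabilities to the classes of `Pt` are within `ε` of the
observed frequencies. -/
noncomputable def refineDecoder (M : Canonical Ω) (Pt Pt' : Partn Ω) (T : ℕ)
    (dec : List Bool → Finset Ω) (m : ℕ) (ε : ℝ) (L : List Bool) : Finset Ω :=
  if h : ∃ y, Pt.cls y = dec (L.take 1 ++ L.tail.drop (m * (T + 1))) ∧
      ∀ C ∈ Finset.univ.image Pt.cls, |freq T dec m C L - probOf M.P y C| < ε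
  then Pt'.cls h.choose else ∅

theorem abs_succMean_sub_probOf_le {M : Canonical Ω} {Pt : Partn Ω} {p : Plan}
    {dec : List Bool → Finset Ω} {δ : ℝ} (ht : IsTest M Pt p dec δ) (x : Ω) {C : Finset Ω}
    (hC : C ∈ Finset.univ.image Pt.cls) :
    |p.succMean M x (fun B => if dec (B.map M.obs) = C then 1 else 0) - probOf M.P x C| ≤ δ := by
  have hy : ∀ y, |(p.mean M y fun l => if dec ((y :: l).map M.obs) = C then (1 : ℝ) else 0) -
      if Pt.cls y = C then 1 else 0| ≤ δ := fun y => by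
    have h1 : (p.mean M y fun l => if dec ((y :: l).map M.obs) = C then (1 : ℝ) else 0) ≤
        p.mean M y fun l => (if Pt.cls y = C then 1 else 0) +
          if dec ((y :: l).map M.obs) = Pt.cls y then 0 else 1 :=
      p.mean_mono M y fun l _ => by split_ifs <;> simp_all
    have h2 : (p.mean M y fun _ => if Pt.cls y = C then (1 : ℝ) else 0) ≤
        p.mean M y fun l => (if dec ((y :: l).map M.obs) = C then 1 else 0) +
          if dec ((y :: l).map M.obs) = Pt.cls y then 0 else 1 :=
      p.mean_mono M y fun l _ => by split_ifs <;> simp_all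
    rw [Plan.mean_add, Plan.mean_const] at h1
    rw [Plan.mean_add, Plan.mean_const] at h2
    have := ht y
    exact abs_le.2 ⟨by linarith, by linarith⟩
  have e : p.succMean M x (fun B => if dec (B.map M.obs) = C then 1 else 0) - probOf M.P x C =
      ∑ y, M.P x y * ((p.mean M y fun l => if dec ((y :: l).map M.obs) = C then (1 : ℝ) else 0) -
        if Pt.cls y = C then 1 else 0) := by
    rw [probOf_eq_sum_ite M.P Pt x hC, Plan.succMean, ← Finset.sum_sub_distrib]
    refine Finset.sum_congr rfl fun y _ => ?_
    rw [mul_sub, mul_ite, mul_one, mul_zero]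
  rw [e]
  calc _ ≤ ∑ y, |M.P x y * ((p.mean M y fun l =>
            if dec ((y :: l).map M.obs) = C then (1 : ℝ) else 0) -
          if Pt.cls y = C then 1 else 0)| := Finset.abs_sum_le_sum_abs _ _
    _ ≤ ∑ y, M.P x y * δ := Finset.sum_le_sum fun y _ => by
        rw [abs_mul, abs_of_nonneg (M.nonneg x y)]
        exact mul_le_mul_of_nonneg_left (hy y) (M.nonneg x y)
    _ = δ := by rw [← Finset.sum_mul, M.sum_one, one_mul]

theorem IsTest.refineDecoder {M : Canonical Ω} {Pt Pt' : Partn Ω} {p : Plan}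
    {dec : List Bool → Finset Ω} {δ ε : ℝ} (ht : IsTest M Pt p dec δ) (hε : 0 < ε) (hε1 : ε ≤ 1)
    (hδ : δ ≤ ε)
    (hsep : ∀ x y, Pt.cls x = Pt.cls y → Pt'.cls x ≠ Pt'.cls y →
      2 * Fintype.card Ω * ε ≤ dTVP M.P Pt x y)
    {m : ℕ} (hm : 0 < m) :
    IsTest M Pt' (p.iter m) (refineDecoder M Pt Pt' p.size dec m (2 * ε))
      (δ + Fintype.card Ω * (2 * Real.exp (-(m * ε ^ 2 / 4)))) := by
  intro x
  set φ : Finset Ω → List Ω → ℝ := fun C B => if dec (B.map M.obs) = C then 1 else 0 with hφ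
  have hcard : (#(Finset.univ.image Pt.cls) : ℝ) ≤ Fintype.card Ω := by
    exact_mod_cast Finset.card_image_le
  calc _ ≤ (p.iter m).mean M x fun l =>
        (if dec ((x :: l.drop (m * (p.size + 1))).map M.obs) = Pt.cls x then 0 else 1) +
        ∑ C ∈ Finset.univ.image Pt.cls,
          if ε ≤ |((blocks p.size m l).map (φ C)).sum / m - p.succMean M x (φ C)|
          then 1 else 0 := ?_
    _ ≤ δ + ∑ C ∈ Finset.univ.image Pt.cls, 2 * Real.exp (-(m * ε ^ 2 / 4)) := by
        rw [Plan.mean_add, Plan.mean_sum, p.mean_iter_drop M x fun l =>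
          if dec ((x :: l).map M.obs) = Pt.cls x then 0 else 1]
        refine add_le_add (ht x) (Finset.sum_le_sum fun C _ => ?_)
        refine p.mean_iter_deviation_le M x (φ C) (fun l => ?_) (fun l => ?_) hε hε1 m hm <;>
        · simp only [hφ]
          split_ifs <;> norm_num
    _ ≤ _ := by
        rw [Finset.sum_const, nsmul_eq_mul]
        gcongr
  refine (p.iter m).mean_mono M x fun l _ => ?_
  have hs : ∀ C ∈ Finset.univ.image Pt.cls, (0 : ℝ) ≤
      if ε ≤ |((blocks p.size m l).map (φ C)).sum / m - p.succMean M x (φ C)| then 1 else 0 :=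
    fun C _ => by split_ifs <;> norm_num
  have hs' := Finset.sum_nonneg hs
  by_cases hroot : dec ((x :: l.drop (m * (p.size + 1))).map M.obs) = Pt.cls x
  swap
  · rw [if_neg hroot]
    split_ifs <;> linarith
  by_cases hdev : ∃ C ∈ Finset.univ.image Pt.cls,
      ε ≤ |((blocks p.size m l).map (φ C)).sum / m - p.succMean M x (φ C)|
  · obtain ⟨C, hC, h⟩ := hdev
    have := Finset.single_le_sum hs hC
    rw [if_pos h] at this
    rw [if_pos hroot]
    split_ifs <;> linarith
  push Not at hdev
  rw [if_pos, if_pos hroot]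
  · linarith
  have hfreq : ∀ C, freq p.size dec m C ((x :: l).map M.obs) =
      ((blocks p.size m l).map (φ C)).sum / m := fun C => by
    simp only [freq, List.map_cons, List.tail_cons, blocks_map, List.map_map]
    rfl
  have hx : ∀ C ∈ Finset.univ.image Pt.cls,
      |freq p.size dec m C ((x :: l).map M.obs) - probOf M.P x C| < 2 * ε := fun C hC => by
    have h1 := abs_lt.1 (hdev C hC)
    have h2 := abs_le.1 (abs_succMean_sub_probOf_le ht x hC)
    rw [hfreq]
    exact abs_lt.2 ⟨by linarith [h1.1, h2.1], by linarith [h1.2, h2.2]⟩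
  have hroot' : Pt.cls x = dec (((x :: l).map M.obs).take 1 ++
      ((x :: l).map M.obs).tail.drop (m * (p.size + 1))) := by
    rw [← hroot]
    simp [List.map_drop]
  have hex : ∃ y, Pt.cls y = dec (((x :: l).map M.obs).take 1 ++
        ((x :: l).map M.obs).tail.drop (m * (p.size + 1))) ∧
      ∀ C ∈ Finset.univ.image Pt.cls,
        |freq p.size dec m C ((x :: l).map M.obs) - probOf M.P y C| < 2 * ε := ⟨x, hroot', hx⟩
  rw [_root_.refineDecoder, dif_pos hex]
  obtain ⟨hy1, hy2⟩ := hex.choose_spec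
  by_contra hne
  have h := hsep _ _ (hy1.trans hroot'.symm) hne
  have hlt : ∑ C ∈ Finset.univ.image Pt.cls, |probOf M.P hex.choose C - probOf M.P x C| <
      ∑ C ∈ Finset.univ.image Pt.cls, 4 * ε := by
    refine Finset.sum_lt_sum_of_nonempty ⟨_, Finset.mem_image_of_mem _ (Finset.mem_univ x)⟩
      fun C hC => ?_
    have h1 := abs_lt.1 (hx C hC)
    have h2 := abs_lt.1 (hy2 C hC)
    exact abs_lt.2 ⟨by linarith [h1.1, h2.2], by linarith [h1.2, h2.1]⟩
  rw [Finset.sum_const, nsmul_eq_mul] at hlt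
  have := mul_le_mul_of_nonneg_right hcard (by linarith : (0 : ℝ) ≤ 4 * ε)
  unfold dTVP at h
  linarith

theorem one_le_toReal_wgt_mul {P : Ω → Ω → ℝ} {Pt Pt' : Partn Ω} (hw : wgt P Pt Pt' ≠ ⊤) {x y : Ω}
    (h : Pt.cls x = Pt.cls y) (h' : Pt'.cls x ≠ Pt'.cls y) :
    1 ≤ (wgt P Pt Pt').toReal * dTVP P Pt x y ^ 2 := by
  have hle : (ENNReal.ofReal (dTVP P Pt x y ^ 2))⁻¹ ≤ wgt P Pt Pt' :=
    le_iSup_of_le x (le_iSup_of_le y (le_iSup_of_le ⟨h, h'⟩ le_rfl))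
  have hpos : 0 < dTVP P Pt x y ^ 2 := by
    by_contra hn
    rw [ENNReal.ofReal_of_nonpos (not_lt.1 hn), ENNReal.inv_zero] at hle
    exact hw (top_le_iff.1 hle)
  have := ENNReal.toReal_mono hw hle
  rw [ENNReal.toReal_inv, ENNReal.toReal_ofReal hpos.le] at this
  rwa [inv_le_iff_one_le_mul₀ hpos] at this

theorem exists_of_wgt_ne_zero {P : Ω → Ω → ℝ} {Pt Pt' : Partn Ω} (hw : wgt P Pt Pt' ≠ 0) :
    ∃ x y, Pt.cls x = Pt.cls y ∧ Pt'.cls x ≠ Pt'.cls y := by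
  by_contra! h
  refine hw ?_
  simp only [wgt, ENNReal.iSup_eq_zero]
  exact fun x y hxy => absurd (h x y hxy.1) hxy.2

theorem Refines.card_lt {Pt Pt' : Partn Ω} (hr : Refines Pt' Pt) {x y : Ω}
    (h : Pt.cls x = Pt.cls y) (h' : Pt'.cls x ≠ Pt'.cls y) :
    #(Finset.univ.image Pt.cls) < #(Finset.univ.image Pt'.cls) := by
  have hF : ∀ z, (Pt'.cls z).biUnion Pt.cls = Pt.cls z := fun z => by
    ext w
    simp only [Finset.mem_biUnion]
    refine ⟨fun ⟨v, hv, hw⟩ => ?_, fun hw => ⟨z, Pt'.mem_cls z, hw⟩⟩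
    rwa [Pt.cls_eq z v (hr z hv)] at hw
  have e : Finset.univ.image Pt.cls =
      (Finset.univ.image Pt'.cls).image fun C => C.biUnion Pt.cls := by
    rw [Finset.image_image]
    exact Finset.image_congr fun z _ => (hF z).symm
  rw [e]
  refine lt_of_le_of_ne Finset.card_image_le fun hc => h' ?_
  refine Finset.card_image_iff.1 hc ?_ ?_ ?_
  · simp
  · simp
  · simp only [hF, h]

theorem isTest_leaf (M : Canonical Ω) (Pt : Partn Ω)
    (h : Pt.cls = fun x => if x = M.sink then {M.sink} else Finset.univ.erase M.sink) :
    IsTest M Pt Plan.leaf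
      (fun L => if L.head? = some true then {M.sink} else Finset.univ.erase M.sink) 0 := by
  intro x
  simp [Plan.mean, h, Canonical.obs]

theorem exists_isTest (M : Canonical Ω) (Ps : ℕ → Partn Ω)
    (h0 : (Ps 0).cls = fun x => if x = M.sink then {M.sink} else Finset.univ.erase M.sink)
    (ε : ℕ → ℝ) (m : ℕ → ℕ) (η : ℝ) (k : ℕ) (hε : ∀ i < k, 0 < ε i) (hε1 : ∀ i < k, ε i ≤ 1)
    (hm : ∀ i < k, 0 < m i) (hη : ∀ i < k, i * η ≤ ε i)
    (hsep : ∀ i < k, ∀ x y, (Ps i).cls x = (Ps i).cls y → (Ps (i + 1)).cls x ≠ (Ps (i + 1)).cls y →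
      2 * Fintype.card Ω * ε i ≤ dTVP M.P (Ps i) x y)
    (hexp : ∀ i < k, Fintype.card Ω * (2 * Real.exp (-(m i * ε i ^ 2 / 4))) ≤ η) :
    ∃ p dec, p.size + 1 = ∏ i ∈ Finset.range k, (m i + 1) ∧ IsTest M (Ps k) p dec (k * η) := by
  induction k with
  | zero => exact ⟨Plan.leaf, _, rfl, by simpa using isTest_leaf M (Ps 0) h0⟩
  | succ k ih =>
    obtain ⟨p, dec, hp, ht⟩ := ih (fun i hi => hε i (by omega)) (fun i hi => hε1 i (by omega))
      (fun i hi => hm i (by omega)) (fun i hi => hη i (by omega)) (fun i hi => hsep i (by omega))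
      (fun i hi => hexp i (by omega))
    have hk := Nat.lt_succ_self k
    refine ⟨p.iter (m k), _, ?_, fun x => (ht.refineDecoder (hε k hk) (hε1 k hk) (hη k hk)
      (hsep k hk) (hm k hk) x).trans ?_⟩
    · rw [Plan.size_iter, hp, Finset.prod_range_succ, mul_comm]
    · have := hexp k hk
      push_cast
      linarith

theorem le_card_of_refines (Ps : ℕ → Partn Ω) (k : ℕ)
    (hr : ∀ i < k, Refines (Ps (i + 1)) (Ps i))
    (hx : ∀ i < k, ∃ x y, (Ps i).cls x = (Ps i).cls y ∧ (Ps (i + 1)).cls x ≠ (Ps (i + 1)).cls y) :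
    k ≤ Fintype.card Ω := by
  have : ∀ i ≤ k, i ≤ #(Finset.univ.image (Ps i).cls) := by
    intro i
    induction i with
    | zero => simp
    | succ i ih =>
      intro hi
      obtain ⟨x, y, h, h'⟩ := hx i (by omega)
      have := (hr i (by omega)).card_lt h h'
      have := ih (by omega)
      omega
  exact (this k le_rfl).trans Finset.card_image_le

theorem mean_ge_of_isTest {M : Canonical Ω} {Pt : Partn Ω} {p : Plan} {dec : List Bool → Finset Ω}
    {δ : ℝ} (ht : IsTest M Pt p dec δ) (x : Ω) :
    1 - δ ≤ p.mean M x fun l => if dec ((x :: l).map M.obs) = Pt.cls x then 1 else 0 := by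
  have h : (p.mean M x fun _ => (1 : ℝ)) ≤ p.mean M x fun l =>
      (if dec ((x :: l).map M.obs) = Pt.cls x then 1 else 0) +
        if dec ((x :: l).map M.obs) = Pt.cls x then 0 else 1 :=
    p.mean_mono M x fun l _ => by split_ifs <;> norm_num
  rw [Plan.mean_const, Plan.mean_add] at h
  linarith [ht x]

/-- A constant bounding the number of samples of one refinement step on `n` states relative to
the weight and the logarithm. -/
noncomputable def stepConst (n : ℝ) : ℝ :=
  16 * n ^ 2 * (Real.log (4 * n ^ 3) / Real.log 2 + 1) + 2 / Real.log 2

theorem ceil_add_one_le {n W L : ℝ} (hn : 1 ≤ n) (hW : 1 ≤ W) (hL : 2 ≤ L) :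
    (⌈16 * n ^ 2 * W * Real.log (4 * n ^ 3 * L)⌉₊ + 1 : ℝ) ≤ stepConst n * W * Real.log L := by
  have h2 : 0 < Real.log 2 := Real.log_pos one_lt_two
  have hlog : Real.log 2 ≤ Real.log L := Real.log_le_log two_pos hL
  have hn3 : 1 ≤ n ^ 3 := one_le_pow₀ hn
  have hl : 0 ≤ Real.log (4 * n ^ 3) := Real.log_nonneg (by linarith)
  have hsplit : Real.log (4 * n ^ 3 * L) = Real.log (4 * n ^ 3) + Real.log L :=
    Real.log_mul (by positivity) (by positivity)
  have hq : 1 ≤ Real.log L / Real.log 2 := (one_le_div h2).2 hlog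
  have h1 : Real.log (4 * n ^ 3) ≤ Real.log (4 * n ^ 3) / Real.log 2 * Real.log L := by
    have := mul_le_mul_of_nonneg_left hq hl
    calc _ = Real.log (4 * n ^ 3) * 1 := (mul_one _).symm
      _ ≤ _ := this
      _ = _ := by ring
  have h3 : 2 ≤ 2 / Real.log 2 * W * Real.log L := by
    have := mul_le_mul hq hW zero_le_one (by linarith)
    calc (2 : ℝ) = 2 * (1 * 1) := by norm_num
      _ ≤ 2 * (Real.log L / Real.log 2 * W) := by linarith
      _ = _ := by ring
  have hc := Nat.ceil_lt_add_one (a := 16 * n ^ 2 * W * Real.log (4 * n ^ 3 * L)) (by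
    rw [hsplit]
    have : 0 ≤ Real.log L := by linarith
    positivity)
  have h4 : 16 * n ^ 2 * W * Real.log (4 * n ^ 3 * L) ≤
      16 * n ^ 2 * W * ((Real.log (4 * n ^ 3) / Real.log 2 + 1) * Real.log L) := by
    rw [hsplit]
    refine mul_le_mul_of_nonneg_left ?_ (by positivity)
    linarith
  unfold stepConst
  linarith

theorem one_le_stepConst {n : ℝ} (hn : 1 ≤ n) : 1 ≤ stepConst n := by
  have h2 : 0 < Real.log 2 := Real.log_pos one_lt_two
  have hn3 : 1 ≤ n ^ 3 := one_le_pow₀ hn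
  have hl : 0 ≤ Real.log (4 * n ^ 3) := Real.log_nonneg (by linarith)
  have h1 : 1 ≤ 16 * n ^ 2 * (Real.log (4 * n ^ 3) / Real.log 2 + 1) := by
    have : 1 ≤ n ^ 2 := one_le_pow₀ hn
    refine one_le_mul_of_one_le_of_one_le (by linarith) ?_
    have : 0 ≤ Real.log (4 * n ^ 3) / Real.log 2 := by positivity
    linarith
  have : 0 < 2 / Real.log 2 := by positivity
  unfold stepConst
  linarith

theorem card_mul_exp_le {n W L : ℝ} (hn : 1 ≤ n) (hW : 1 ≤ W) (hL : 2 ≤ L) :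
    n * (2 * Real.exp (-(⌈16 * n ^ 2 * W * Real.log (4 * n ^ 3 * L)⌉₊ *
      (1 / (2 * n * √W)) ^ 2 / 4))) ≤ 1 / (2 * n ^ 2 * L) := by
  have hsq : √W ^ 2 = W := Real.sq_sqrt (by linarith)
  have h : Real.log (4 * n ^ 3 * L) ≤ ⌈16 * n ^ 2 * W * Real.log (4 * n ^ 3 * L)⌉₊ *
      (1 / (2 * n * √W)) ^ 2 / 4 := by
    have e : (1 / (2 * n * √W)) ^ 2 / 4 = 1 / (16 * n ^ 2 * W) := by
      rw [div_pow, mul_pow, mul_pow, hsq]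
      field_simp
      norm_num
    rw [mul_div_assoc, e, mul_one_div, le_div_iff₀ (by positivity), mul_comm]
    exact Nat.le_ceil _
  have hexp := Real.exp_le_exp.2 (neg_le_neg h)
  rw [Real.exp_neg (Real.log _), Real.exp_log (by positivity)] at hexp
  calc _ ≤ n * (2 * (4 * n ^ 3 * L)⁻¹) := by gcongr
    _ = _ := by
      field_simp
      norm_num

theorem stmt_9 :
    ∀ n : ℕ, 3 ≤ n → ∃ c : ℝ, 0 < c ∧
      ∀ (Ω : Type) [Fintype Ω] [DecidableEq Ω] (M : Canonical Ω),
        Fintype.card Ω = n →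
        ∀ (k : ℕ) (Ps : ℕ → Partn Ω),
          (Ps 0).cls =
              (fun x => if x = M.sink then {M.sink} else Finset.univ.erase M.sink) →
          (∀ i : ℕ, i < k → Refines (Ps (i + 1)) (Ps i) ∧ wgt M.P (Ps i) (Ps (i + 1)) ≠ ⊤) →
          ∀ L : ℝ, L = (∏ i ∈ Finset.range k, wgt M.P (Ps i) (Ps (i + 1))).toReal → 2 ≤ L →
          ∃ A : List Bool → ℕ, NonAdaptive A ∧
            ∃ T : ℕ, (T : ℝ) ≤ c * L * Real.log L ^ k ∧
              ∃ f : (Fin (T + 1) → Bool) → Finset Ω,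
                ∀ x : Ω,
                  2 / 3 ≤ ∑ z : Fin (T + 1) → Bool,
                    if f z = (Ps k).cls x then obsSeqProb M A x T z else 0 := by
  intro n hn
  have hn1 : (1 : ℝ) ≤ n := by exact_mod_cast (by omega : 1 ≤ n)
  have hK := one_le_stepConst hn1
  refine ⟨stepConst n ^ n, by positivity, ?_⟩
  intro Ω _ _ M hcard k Ps h0 hPs L hL hL2
  set W : ℕ → ℝ := fun i => (wgt M.P (Ps i) (Ps (i + 1))).toReal with hW
  have hLW : L = ∏ i ∈ Finset.range k, W i := by rw [hL, ENNReal.toReal_prod]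
  have hpair : ∀ i < k, ∃ x y, (Ps i).cls x = (Ps i).cls y ∧
      (Ps (i + 1)).cls x ≠ (Ps (i + 1)).cls y := fun i hi => by
    refine exists_of_wgt_ne_zero (P := M.P) fun h => ?_
    rw [Finset.prod_eq_zero (Finset.mem_range.2 hi) h, ENNReal.toReal_zero] at hL
    linarith
  have hW1 : ∀ i < k, 1 ≤ W i := fun i hi => by
    obtain ⟨x, y, h, h'⟩ := hpair i hi
    exact (one_le_toReal_wgt_mul (hPs i hi).2 h h').trans (mul_le_of_le_one_right
      ENNReal.toReal_nonneg (pow_le_one₀ (dTVP_nonneg _ _ _ _) (dTVP_le_one M _ _ _)))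
  have hWL : ∀ i < k, W i ≤ L := fun i hi => by
    have hi' := Finset.mem_range.2 hi
    rw [hLW, ← Finset.mul_prod_erase _ _ hi']
    refine le_mul_of_one_le_right (by linarith [hW1 i hi]) ?_
    rw [← Finset.prod_const_one (s := (Finset.range k).erase i)]
    exact Finset.prod_le_prod (fun _ _ => zero_le_one) fun j hj =>
      hW1 j (Finset.mem_range.1 (Finset.mem_of_mem_erase hj))
  have hkn : k ≤ n := hcard ▸ le_card_of_refines Ps k (fun i hi => (hPs i hi).1) hpair
  have hkn' : (k : ℝ) ≤ n := by exact_mod_cast hkn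
  have hs1 : ∀ i < k, 1 ≤ √(W i) := fun i hi => Real.one_le_sqrt.2 (hW1 i hi)
  have hsL : ∀ i < k, √(W i) ≤ L := fun i hi =>
    (Real.sqrt_le_iff.2 ⟨by linarith [hW1 i hi], by nlinarith [hW1 i hi]⟩).trans (hWL i hi)
  have hnη : n * (1 / (2 * (n : ℝ) ^ 2 * L)) = 1 / (2 * n * L) := by field_simp
  have hkη : ∀ i ≤ k, i * (1 / (2 * (n : ℝ) ^ 2 * L)) ≤ 1 / (2 * n * L) := fun i hi => by
    rw [← hnη]
    have : (i : ℝ) ≤ n := by exact_mod_cast hi.trans hkn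
    gcongr
  obtain ⟨p, dec, hp, ht⟩ := exists_isTest M Ps h0 (fun i => 1 / (2 * n * √(W i)))
    (fun i => ⌈16 * (n : ℝ) ^ 2 * W i * Real.log (4 * n ^ 3 * L)⌉₊) (1 / (2 * n ^ 2 * L)) k
    (fun i hi => by have := hs1 i hi; positivity)
    (fun i hi => by
      have := hs1 i hi
      rw [div_le_one (by positivity)]
      nlinarith)
    (fun i hi => Nat.ceil_pos.2 (by
      have := hW1 i hi
      have : 0 < Real.log (4 * n ^ 3 * L) := Real.log_pos (by
        have : (1 : ℝ) ≤ n ^ 3 := one_le_pow₀ hn1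
        nlinarith)
      positivity))
    (fun i hi => (hkη i hi.le).trans (by
      have := hs1 i hi
      have := hsL i hi
      gcongr))
    (fun i hi x y h h' => by
      have hs := hs1 i hi
      have hw := one_le_toReal_wgt_mul (hPs i hi).2 h h'
      have hd := dTVP_nonneg M.P (Ps i) x y
      have e : 2 * (n : ℝ) * (1 / (2 * n * √(W i))) = 1 / √(W i) := by field_simp
      rw [hcard, e, div_le_iff₀ (by positivity)]
      have : 1 ≤ (dTVP M.P (Ps i) x y * √(W i)) ^ 2 := by
        rwa [mul_pow, Real.sq_sqrt ENNReal.toReal_nonneg, mul_comm]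
      exact (one_le_sq_iff₀ (by positivity)).1 this)
    (fun i hi => by
      rw [hcard]
      exact card_mul_exp_le hn1 (hW1 i hi) hL2)
  refine ⟨_, nonAdaptive_rewindTo fun t => (p.parents 0 1).getD t 0, p.size, ?_,
    fun z => dec (List.ofFn z), fun x => ?_⟩
  · have hlog : 0 ≤ Real.log L := Real.log_nonneg (by linarith)
    calc (p.size : ℝ) ≤ ((p.size + 1 : ℕ) : ℝ) := by push_cast; linarith
      _ = ∏ i ∈ Finset.range k,
          (⌈16 * (n : ℝ) ^ 2 * W i * Real.log (4 * n ^ 3 * L)⌉₊ + 1 : ℝ) := by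
          rw [hp]
          push_cast
          rfl
      _ ≤ ∏ i ∈ Finset.range k, stepConst n * W i * Real.log L :=
          Finset.prod_le_prod (fun _ _ => by positivity) fun i hi =>
            ceil_add_one_le hn1 (hW1 i (Finset.mem_range.1 hi)) hL2
      _ = stepConst n ^ k * L * Real.log L ^ k := by
          rw [Finset.prod_mul_distrib, Finset.prod_mul_distrib, ← hLW]
          simp
      _ ≤ _ := by gcongr
  · rw [sum_obsSeqProb_parents M p x dec]
    refine le_trans ?_ (mean_ge_of_isTest ht x)
    have h := hkη k le_rfl
    have : 1 / (2 * (n : ℝ) * L) ≤ 1 / 3 := by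
      have : (3 : ℝ) ≤ n := by exact_mod_cast hn
      refine one_div_le_one_div_of_le (by norm_num) ?_
      nlinarith
    linarith
end

section
/- In the chain M₀, rewinding strictly outperforms passive observation: let D ≥ 2 and consider sampling X₁ from P(·|X₀) and then D states Y₁, …, Y_D independently, each from P(·|X₁) (this is realized by the non-adaptive rewinding strategy A with A(z₀,…,z_t) = max(t−1, 0)). If X₀ = a then almost surely all the observations O(Y₁), …, O(Y_D) are equal, while if X₀ = a' then with probability 1 − 2^{1−D} they are not all equal. In particular, taking D = 2 gives d_TV(D₃^{A,a}, D₃^{A,a'}) ≥ 1/2, and hence NAQC_{M₀}(a, a') ≤ 3, even though the passive strategy yields identical observation distributions from a and a' at every time horizon. -/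
open Finset
open scoped ENNReal

variable {Ω : Type} [Fintype Ω] [DecidableEq Ω]

/-- Transition probabilities of the chain `M₀` on states `a = 0`, `b = 1`, `a' = 2`,
`b' = 3`, `s = 4`: `P(a|a) = P(b|a) = 1/2`, `P(s|b) = 1`, `P(b'|a') = 1`,
`P(b'|b') = P(s|b') = 1/2`, `P(s|s) = 1`. -/
noncomputable def M0P : Fin 5 → Fin 5 → ℝ := fun i j =>
  if i = 0 then (if j = 0 then 1 / 2 else if j = 1 then 1 / 2 else 0)
  else if i = 1 then (if j = 4 then 1 else 0)
  else if i = 2 then (if j = 3 then 1 else 0)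
  else if i = 3 then (if j = 3 then 1 / 2 else if j = 4 then 1 / 2 else 0)
  else (if j = 4 then 1 else 0)

theorem extendTraj_val {Ω : Type} (T : ℕ) (f : Fin (T + 1) → Ω) (i : Fin (T + 1)) :
    extendTraj T f i = f i := by
  unfold extendTraj
  congr 1
  ext
  exact min_eq_left (Nat.le_of_lt_succ i.isLt)

/-- Under the strategy that always rewinds to time `1`, the trajectory probability factors through
the state at time `1`. -/
theorem trajProb_rewind_one (M : Canonical Ω) (D : ℕ) (f : Fin (D + 2) → Ω) :
    trajProb M (fun l => l.length - 2) (D + 1) (extendTraj (D + 1) f) =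
      M.P (f 0) (f 1) * ∏ i : Fin D, M.P (f 1) (f i.succ.succ) := by
  have hval : ∀ i : Fin (D + 2), extendTraj (D + 1) f i = f i := extendTraj_val (D + 1) f
  unfold trajProb
  rw [Finset.prod_range_succ', mul_comm, Finset.prod_range]
  refine congrArg₂ (· * ·) ?_ ?_
  · have h0 := hval 0
    have h1 := hval 1
    simp only [Fin.val_zero, Fin.val_one] at h0 h1
    simp only [Nat.zero_sub, Nat.zero_add, h0, h1]
  · refine Finset.prod_congr rfl fun i _ => ?_
    have h1 := hval 1
    have h2 := hval i.succ.succ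
    simp only [Fin.val_one, Fin.val_succ] at h1 h2
    have ht : (i : ℕ) + 1 - ((obsHist M (extendTraj (D + 1) f) (i + 1)).length - 2) = 1 := by
      simp [obsHist]
    rw [ht, h1, h2]

theorem sum_ite_obsSeqProb (M : Canonical Ω) (A : List Bool → ℕ) (x : Ω) (T : ℕ)
    (Q : (Fin (T + 1) → Bool) → Prop) [DecidablePred Q] :
    (∑ z, if Q z then obsSeqProb M A x T z else 0) =
      ∑ f : Fin (T + 1) → Ω,
        if f 0 = x ∧ Q (fun i => M.obs (f i)) then trajProb M A T (extendTraj T f) else 0 := by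
  have h : ∀ z, (if Q z then obsSeqProb M A x T z else 0) =
      ∑ f : Fin (T + 1) → Ω, if (fun i => M.obs (f i)) = z then
        (if f 0 = x ∧ Q (fun i => M.obs (f i)) then trajProb M A T (extendTraj T f) else 0)
        else 0 := by
    intro z
    unfold obsSeqProb
    by_cases hz : Q z
    · rw [if_pos hz]
      refine Finset.sum_congr rfl fun f _ => ?_
      by_cases hf : (fun i => M.obs (f i)) = z
      · subst hf
        simp [hz]
      · rw [if_neg hf, if_neg fun h => hf (funext h.2)]
    · rw [if_neg hz]
      refine (Finset.sum_eq_zero fun f _ => ?_).symm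
      split_ifs with hf h
      · exact absurd (hf ▸ h.2) hz
      · rfl
      · rfl
  rw [Finset.sum_congr rfl fun z _ => h z, Finset.sum_comm]
  simp

theorem sum_pi_succ {α : Type*} [Fintype α] {n : ℕ} (F : (Fin (n + 1) → α) → ℝ) :
    ∑ f, F f = ∑ y, ∑ h : Fin n → α, F (Fin.cons y h) := by
  rw [← Fintype.sum_prod_type', ← (Fin.consEquiv fun _ : Fin (n + 1) => α).sum_comp]
  rfl

/-- The law of the observations when all samples after the first are drawn from the state at
time `1`. -/
theorem sum_ite_obsSeqProb_rewind_one (M : Canonical Ω) (x : Ω) (D : ℕ)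
    (Q : (Fin (D + 2) → Bool) → Prop) (R : (Fin D → Bool) → Prop)
    [DecidablePred Q] [DecidablePred R] (hQR : ∀ z, Q z ↔ R fun i => z i.succ.succ) :
    (∑ z, if Q z then obsSeqProb M (fun l => l.length - 2) x (D + 1) z else 0) =
      ∑ y, M.P x y * ∑ h : Fin D → Ω,
        if R (fun i => M.obs (h i)) then ∏ i, M.P y (h i) else 0 := by
  rw [sum_ite_obsSeqProb, sum_pi_succ, Finset.sum_eq_single x]
  · rw [sum_pi_succ]
    refine Finset.sum_congr rfl fun y _ => ?_
    rw [Finset.mul_sum]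
    refine Finset.sum_congr rfl fun h _ => ?_
    have h1 : (Fin.cons x (Fin.cons y h : Fin (D + 1) → Ω) : Fin (D + 2) → Ω) 1 = y := rfl
    simp [trajProb_rewind_one, hQR, h1]
  · intro y _ hy
    simp [hy]
  · simp

theorem sum_obsSeqProb_rewind_one (M : Canonical Ω) (x : Ω) (D : ℕ) :
    ∑ z, obsSeqProb M (fun l => l.length - 2) x (D + 1) z = 1 := by
  have h := sum_ite_obsSeqProb_rewind_one M x D (fun _ => True) (fun _ => True) (by simp)
  simp only [if_true] at h
  rw [h]
  simp [← Fintype.prod_sum, M.sum_one]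

theorem sum_ite_obs_eq_prod (M : Canonical Ω) (y : Ω) (D : ℕ) (c : Bool) :
    (∑ h : Fin D → Ω, if ∀ i, M.obs (h i) = c then ∏ i, M.P y (h i) else 0) =
      (∑ w, if M.obs w = c then M.P y w else 0) ^ D := by
  rw [Finset.sum_pow', Fintype.piFinset_univ]
  refine Finset.sum_congr rfl fun h _ => ?_
  rw [Finset.prod_ite_zero]
  simp

/-- The probability that all the samples drawn from the state at time `1` have the same
observation. -/
theorem sum_ite_allEq_obsSeqProb_rewind_one (M : Canonical Ω) (x : Ω) (D : ℕ) (hD : 1 ≤ D) :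
    (∑ z : Fin (D + 2) → Bool,
      if (∀ i j : Fin (D + 2), 2 ≤ (i : ℕ) → 2 ≤ (j : ℕ) → z i = z j) then
        obsSeqProb M (fun l => l.length - 2) x (D + 1) z else 0) =
      ∑ y, M.P x y * (M.P y M.sink ^ D + (1 - M.P y M.sink) ^ D) := by
  rw [sum_ite_obsSeqProb_rewind_one M x D _
    (fun u => (∀ i, u i = true) ∨ (∀ i, u i = false))]
  · refine Finset.sum_congr rfl fun y _ => ?_
    congr 1
    have htrue : (∑ w, if M.obs w = true then M.P y w else 0) = M.P y M.sink := by
      simp [Canonical.obs]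
    have hfalse : (∑ w, if M.obs w = false then M.P y w else 0) = 1 - M.P y M.sink := by
      rw [← htrue, ← M.sum_one y, ← Finset.sum_sub_distrib]
      refine Finset.sum_congr rfl fun w _ => ?_
      cases M.obs w <;> simp
    rw [← hfalse, ← htrue, ← sum_ite_obs_eq_prod, ← sum_ite_obs_eq_prod, ← Finset.sum_add_distrib]
    refine Finset.sum_congr rfl fun h _ => ?_
    by_cases ht : ∀ i, M.obs (h i) = true
    · have hf : ¬ ∀ i, M.obs (h i) = false := fun hf => by
        simpa [ht ⟨0, hD⟩] using hf ⟨0, hD⟩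
      rw [if_pos (Or.inl ht), if_pos ht, if_neg hf, add_zero]
    · simp only [ht, false_or, if_false, zero_add]
  · intro z
    constructor
    · intro hz
      have hi : ∀ i : Fin D, z i.succ.succ = z (Fin.succ (Fin.succ ⟨0, hD⟩)) := fun i =>
        hz _ _ (by simp) (by simp)
      cases hc : z (Fin.succ (Fin.succ ⟨0, hD⟩))
      · exact Or.inr fun i => (hi i).trans hc
      · exact Or.inl fun i => (hi i).trans hc
    · intro hz i j hi hj
      have hshift : ∀ k : Fin (D + 2), 2 ≤ (k : ℕ) → ∃ m : Fin D, k = m.succ.succ := fun k hk =>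
        ⟨⟨k - 2, by omega⟩, by ext; simp; omega⟩
      obtain ⟨m, rfl⟩ := hshift i hi
      obtain ⟨n, rfl⟩ := hshift j hj
      rcases hz with hz | hz
      · exact (hz m).trans (hz n).symm
      · exact (hz m).trans (hz n).symm

theorem obsSeqProb_zero (M : Canonical Ω) (A : List Bool → ℕ) (x : Ω) (z : Fin 1 → Bool) :
    obsSeqProb M A x 0 z = if M.obs x = z 0 then 1 else 0 := by
  unfold obsSeqProb
  rw [sum_pi_succ, Finset.sum_eq_single x]
  · simp [trajProb]
  · intro y _ hy
    simp [hy]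
  · simp

theorem trajProb_passive_cons (M : Canonical Ω) (T : ℕ) (x : Ω) (f : Fin (T + 1) → Ω) :
    trajProb M (fun _ => 0) (T + 1) (extendTraj (T + 1) (Fin.cons x f)) =
      M.P x (f 0) * trajProb M (fun _ => 0) T (extendTraj T f) := by
  have hsucc : ∀ t, extendTraj (T + 1) (Fin.cons x f) (t + 1) = extendTraj T f t := by
    intro t
    have : (⟨min (t + 1) (T + 1), by omega⟩ : Fin (T + 2)) = Fin.succ ⟨min t T, by omega⟩ := by
      ext; simp
    simp only [extendTraj, this, Fin.cons_succ]
  unfold trajProb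
  rw [Finset.prod_range_succ', mul_comm]
  simp only [Nat.sub_zero, hsucc]
  congr 1

/-- One-step recursion for the observation distribution of passive observation. -/
theorem obsSeqProb_passive_succ (M : Canonical Ω) (x : Ω) (T : ℕ) (z : Fin (T + 2) → Bool) :
    obsSeqProb M (fun _ => 0) x (T + 1) z =
      if M.obs x = z 0 then ∑ y, M.P x y * obsSeqProb M (fun _ => 0) y T (Fin.tail z) else 0 := by
  have hstart : obsSeqProb M (fun _ => 0) x (T + 1) z =
      ∑ f : Fin (T + 1) → Ω, if M.obs x = z 0 ∧ ∀ i, M.obs (f i) = Fin.tail z i then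
        M.P x (f 0) * trajProb M (fun _ => 0) T (extendTraj T f) else 0 := by
    conv_lhs => unfold obsSeqProb
    rw [sum_pi_succ, Finset.sum_eq_single x]
    · refine Finset.sum_congr rfl fun f _ => if_congr ?_ (trajProb_passive_cons M T x f) rfl
      simp [Fin.forall_fin_succ (n := T + 1), Fin.tail]
    · intro y _ hy
      simp [hy]
    · simp
  rw [hstart]
  split_ifs with hx
  · simp only [obsSeqProb, Finset.mul_sum]
    rw [Finset.sum_comm]
    refine Finset.sum_congr rfl fun f _ => ?_
    simp [hx, ite_and]
  · simp [hx]

theorem sum_signed_le_two_mul_obsTV (M : Canonical Ω) (A : List Bool → ℕ) (a b : Ω) (T : ℕ)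
    (Q : (Fin (T + 1) → Bool) → Prop) [DecidablePred Q] :
    (∑ z, if Q z then obsSeqProb M A a T z else 0) -
      (∑ z, if Q z then obsSeqProb M A b T z else 0) -
      ((∑ z, if ¬ Q z then obsSeqProb M A a T z else 0) -
      (∑ z, if ¬ Q z then obsSeqProb M A b T z else 0)) ≤ 2 * obsTV M A a b T := by
  unfold obsTV
  rw [← mul_assoc, mul_one_div_cancel two_ne_zero, one_mul, ← Finset.sum_sub_distrib,
    ← Finset.sum_sub_distrib, ← Finset.sum_sub_distrib]
  refine Finset.sum_le_sum fun z _ => ?_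
  by_cases hz : Q z
  · simpa [hz] using le_abs_self (obsSeqProb M A a T z - obsSeqProb M A b T z)
  · simpa [hz] using neg_le_abs (obsSeqProb M A a T z - obsSeqProb M A b T z)

theorem sum_ite_not_eq_sub {α : Type*} [Fintype α] (Q : α → Prop) [DecidablePred Q] (p : α → ℝ) :
    (∑ z, if ¬ Q z then p z else 0) = ∑ z, p z - ∑ z, if Q z then p z else 0 := by
  rw [← Finset.sum_sub_distrib]
  refine Finset.sum_congr rfl fun z _ => ?_
  by_cases hz : Q z <;> simp [hz]

theorem half_obsSeqProb_passive_add (M : Canonical (Fin 5)) (hP : M.P = M0P) (hs : M.sink = 4)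
    (T : ℕ) (z : Fin (T + 1) → Bool) :
    1 / 2 * obsSeqProb M (fun _ => 0) 0 T z + 1 / 2 * obsSeqProb M (fun _ => 0) 1 T z =
      obsSeqProb M (fun _ => 0) 3 T z := by
  induction T with
  | zero =>
    simp only [obsSeqProb_zero, Canonical.obs, hs]
    cases z 0 <;> simp <;> norm_num
  | succ T ih =>
    have h := ih (Fin.tail z)
    simp only [obsSeqProb_passive_succ, Canonical.obs, hs, hP, M0P, Fin.sum_univ_five]
    cases z 0 <;> simp <;> linarith

theorem stmt_17 (M : Canonical (Fin 5)) (hP : M.P = M0P) (hs : M.sink = 4) :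
    NonAdaptive (fun l : List Bool => l.length - 2) ∧
    (∀ D : ℕ, 2 ≤ D →
      (∑ z : Fin (D + 2) → Bool,
          if (∀ i j : Fin (D + 2), 2 ≤ (i : ℕ) → 2 ≤ (j : ℕ) → z i = z j) then
            obsSeqProb M (fun l => l.length - 2) 0 (D + 1) z
          else 0) = 1 ∧
      (∑ z : Fin (D + 2) → Bool,
          if ¬ (∀ i j : Fin (D + 2), 2 ≤ (i : ℕ) → 2 ≤ (j : ℕ) → z i = z j) then
            obsSeqProb M (fun l => l.length - 2) 2 (D + 1) z
          else 0) = 1 - (1 / 2 : ℝ) ^ (D - 1)) ∧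
    1 / 2 ≤ obsTV M (fun l : List Bool => l.length - 2) 0 2 3 ∧
    NAQC M 0 2 ≤ (3 : ℝ≥0∞) ∧
    (∀ (T : ℕ) (z : Fin (T + 1) → Bool),
        obsSeqProb M (fun _ => 0) 0 T z = obsSeqProb M (fun _ => 0) 2 T z) := by
  have hna : NonAdaptive (fun l : List Bool => l.length - 2) := by
    intro l₁ l₂ h
    simp [h]
  have heq0 : ∀ D : ℕ, 2 ≤ D → (∑ z : Fin (D + 2) → Bool,
      if (∀ i j : Fin (D + 2), 2 ≤ (i : ℕ) → 2 ≤ (j : ℕ) → z i = z j) then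
        obsSeqProb M (fun l => l.length - 2) 0 (D + 1) z else 0) = 1 := by
    intro D hD
    have hD0 : D ≠ 0 := by omega
    rw [sum_ite_allEq_obsSeqProb_rewind_one M 0 D (by omega), hs, hP]
    simp [M0P, Fin.sum_univ_five, hD0]
    norm_num
  have heq2 : ∀ D : ℕ, 2 ≤ D → (∑ z : Fin (D + 2) → Bool,
      if (∀ i j : Fin (D + 2), 2 ≤ (i : ℕ) → 2 ≤ (j : ℕ) → z i = z j) then
        obsSeqProb M (fun l => l.length - 2) 2 (D + 1) z else 0) = (1 / 2 : ℝ) ^ (D - 1) := by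
    intro D hD
    obtain ⟨k, rfl⟩ : ∃ k, D = k + 1 := ⟨D - 1, by omega⟩
    rw [sum_ite_allEq_obsSeqProb_rewind_one M 2 (k + 1) (by omega), hs, hP]
    have hhalf : (1 : ℝ) - 2⁻¹ = 2⁻¹ := by norm_num
    simp [M0P, hhalf, pow_succ]
    ring
  have hTV : 1 / 2 ≤ obsTV M (fun l : List Bool => l.length - 2) 0 2 3 := by
    have h := sum_signed_le_two_mul_obsTV M (fun l : List Bool => l.length - 2) 0 2 3
      (fun z => ∀ i j : Fin 4, 2 ≤ (i : ℕ) → 2 ≤ (j : ℕ) → z i = z j)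
    have h0 := heq0 2 le_rfl
    have h2 := heq2 2 le_rfl
    norm_num only [sum_ite_not_eq_sub, sum_obsSeqProb_rewind_one M _ 2] at h h0 h2
    rw [h0, h2] at h
    linarith
  refine ⟨hna, fun D hD => ⟨heq0 D hD, ?_⟩, hTV, ?_, ?_⟩
  · rw [sum_ite_not_eq_sub, sum_obsSeqProb_rewind_one, heq2 D hD]
  · refine (iInf_le _ ⟨_, hna⟩).trans (sInf_le ⟨3, by norm_num, ?_⟩)
    linarith
  · intro T z
    cases T with
    | zero =>
      simp only [obsSeqProb_zero, Canonical.obs, hs]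
      cases z 0 <;> simp
    | succ T =>
      have h := half_obsSeqProb_passive_add M hP hs T (Fin.tail z)
      simp only [obsSeqProb_passive_succ, Canonical.obs, hs, hP, M0P, Fin.sum_univ_five]
      cases z 0 <;> simp <;> linarith
end
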